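/- Let n ≥ 1, let d ≥ 2 be even, and let ‖·‖ be an O(n)-invariant norm on F_{d,n}. Set κ = (Γ(1+n/d)/Γ(1+n/2))^{d/n} π^{d/2}. Then among all f ∈ F_{d,n} with ∫_{ℝⁿ} exp(−f(x)) dx ≤ 1, the norm ‖f‖ is minimized uniquely by f = κ·b_{d,n}, and the minimum value equals κ·‖b_{d,n}‖. -/

import Mathlib

open MvPolynomial MeasureTheory Real Finset Matrix

/-- `b_{d,n}(x) = (x₁² + ⋯ + x_n²)^{d/2} = |x|^d`. -/
noncomputable def ballForm (n d : ℕ) : MvPolynomial (Fin n) ℝ :=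
  (∑ i : Fin n, X i ^ 2) ^ (d / 2)

/-- `ρ*f`: the form `x ↦ f(ρ⁻¹ x)`. -/
noncomputable def rotate (n : ℕ) (ρ : Matrix (Fin n) (Fin n) ℝ)
    (f : MvPolynomial (Fin n) ℝ) : MvPolynomial (Fin n) ℝ :=
  aeval (fun i => ∑ j : Fin n, C (ρ⁻¹ i j) * X j) f

/-- `κ = (Γ(1+n/d)/Γ(1+n/2))^{d/n} · π^{d/2}`. -/
noncomputable def kappa (n d : ℕ) : ℝ :=
  (Real.Gamma (1 + (n : ℝ) / d) / Real.Gamma (1 + (n : ℝ) / 2)) ^ ((d : ℝ) / n)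
    * π ^ ((d : ℝ) / 2)

theorem eval_rotate (n : ℕ) (ρ : Matrix (Fin n) (Fin n) ℝ) (f : MvPolynomial (Fin n) ℝ)
    (x : Fin n → ℝ) : eval x (rotate n ρ f) = eval (ρ⁻¹ *ᵥ x) f := by
  rw [rotate, aeval_def, MvPolynomial.algebraMap_eq, eval_eval₂]
  have h : (eval x).comp (C : ℝ →+* MvPolynomial (Fin n) ℝ) = RingHom.id ℝ := by
    ext; simp
  rw [h, eval₂_id]
  congr 2
  funext i
  simp [mulVec, dotProduct]

theorem isHomogeneous_rotate {n d : ℕ} (ρ : Matrix (Fin n) (Fin n) ℝ)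
    {f : MvPolynomial (Fin n) ℝ} (hf : f.IsHomogeneous d) : (rotate n ρ f).IsHomogeneous d := by
  rw [← one_mul d]
  exact hf.aeval _ fun i => IsHomogeneous.sum Finset.univ _ 1
    fun j _ => isHomogeneous_C_mul_X (ρ⁻¹ i j) j

theorem eval_smul_of_isHomogeneous {n d : ℕ} {f : MvPolynomial (Fin n) ℝ}
    (hf : f.IsHomogeneous d) (s : ℝ) (x : Fin n → ℝ) :
    eval (s • x) f = s ^ d * eval x f := by
  rw [eval_eq, eval_eq, Finset.mul_sum]
  refine Finset.sum_congr rfl fun m hm => ?_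
  simp only [Pi.smul_apply, smul_eq_mul, mul_pow, Finset.prod_mul_distrib]
  rw [Finset.prod_pow_eq_pow_sum]
  have h : ∑ i ∈ m.support, m i = d := (hf.degree_eq_sum_deg_support hm).symm
  rw [h]
  ring

theorem isHomogeneous_ballForm {n d : ℕ} (hd : Even d) : (ballForm n d).IsHomogeneous d := by
  have h : (∑ i : Fin n, (X i : MvPolynomial (Fin n) ℝ) ^ 2).IsHomogeneous 2 :=
    IsHomogeneous.sum Finset.univ _ 2 fun i _ => isHomogeneous_X_pow i 2
  simpa [ballForm, Nat.two_mul_div_two_of_even hd] using h.pow (d / 2)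

theorem eval_ballForm (n d : ℕ) (x : Fin n → ℝ) :
    eval x (ballForm n d) = (x ⬝ᵥ x) ^ (d / 2) := by
  simp [ballForm, dotProduct, pow_two]

/-- `∫ exp(-f)`, as an extended nonnegative real. -/
noncomputable def expIntegral {n : ℕ} (f : MvPolynomial (Fin n) ℝ) : ENNReal :=
  ∫⁻ x : Fin n → ℝ, ENNReal.ofReal (Real.exp (-(eval x f)))

theorem continuous_exp_neg_eval {n : ℕ} (f : MvPolynomial (Fin n) ℝ) :
    Continuous fun x : Fin n → ℝ => Real.exp (-(eval x f)) := by
  have := MvPolynomial.continuous_eval f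
  fun_prop

/-- Strict monotonicity of the integral for continuous functions. -/
theorem lintegral_ofReal_lt_of_continuous {n : ℕ} {F G : (Fin n → ℝ) → ℝ} (hF : Continuous F)
    (hG : Continuous G) (hF0 : ∀ x, 0 ≤ F x) (hle : ∀ x, F x ≤ G x) (hlt : ∃ x, F x < G x)
    (hfin : ∫⁻ x, ENNReal.ofReal (F x) ≠ ⊤) :
    ∫⁻ x, ENNReal.ofReal (F x) < ∫⁻ x, ENNReal.ofReal (G x) := by
  refine lintegral_strict_mono_of_ae_le_of_ae_lt_on (s := {x | F x < G x})
    hG.measurable.ennreal_ofReal.aemeasurable hfin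
    (Filter.Eventually.of_forall fun x => ENNReal.ofReal_le_ofReal (hle x)) ?_
    (Filter.Eventually.of_forall fun x hx => ?_)
  · exact ((isOpen_lt hF hG).measure_pos volume hlt).ne'
  · exact (ENNReal.ofReal_lt_ofReal_iff_of_nonneg (hF0 x)).2 hx

theorem expIntegral_midpoint_lt {n : ℕ} {f g : MvPolynomial (Fin n) ℝ} (hfg : f ≠ g)
    (hf : expIntegral f ≤ 1) (hg : expIntegral g ≤ 1) :
    expIntegral ((1 / 2 : ℝ) • (f + g)) < 1 := by
  have hmf := (continuous_exp_neg_eval f)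
  have hmg := (continuous_exp_neg_eval g)
  set G : (Fin n → ℝ) → ℝ := fun x =>
    (1 / 2) * Real.exp (-(eval x f)) + (1 / 2) * Real.exp (-(eval x g)) with hGdef
  have hG : ∫⁻ x, ENNReal.ofReal (G x) ≤ 1 := by
    have h1 : ∀ x, ENNReal.ofReal (G x) = ENNReal.ofReal (1 / 2) *
        ENNReal.ofReal (Real.exp (-(eval x f))) + ENNReal.ofReal (1 / 2) *
        ENNReal.ofReal (Real.exp (-(eval x g))) := fun x => by
      rw [hGdef, ENNReal.ofReal_add (by positivity) (by positivity),
        ENNReal.ofReal_mul (by norm_num), ENNReal.ofReal_mul (by norm_num)]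
    simp_rw [h1]
    rw [lintegral_add_left (hmf.measurable.ennreal_ofReal.const_mul _),
      lintegral_const_mul _ hmf.measurable.ennreal_ofReal,
      lintegral_const_mul _ hmg.measurable.ennreal_ofReal]
    calc _ ≤ ENNReal.ofReal (1 / 2) * 1 + ENNReal.ofReal (1 / 2) * 1 := by gcongr <;> assumption
      _ = 1 := by
        rw [mul_one, ← ENNReal.ofReal_add (by norm_num) (by norm_num)]; norm_num
  have hev : ∀ x, eval x ((1 / 2 : ℝ) • (f + g)) = (1 / 2) * (eval x f + eval x g) := fun x => by
    simp [mul_add]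
  have hle : ∀ x, Real.exp (-(eval x ((1 / 2 : ℝ) • (f + g)))) ≤ G x := fun x => by
    rw [hev]
    have := convexOn_exp.2 (Set.mem_univ (-(eval x f))) (Set.mem_univ (-(eval x g)))
      (by norm_num : (0 : ℝ) ≤ 1 / 2) (by norm_num : (0 : ℝ) ≤ 1 / 2) (by norm_num)
    simp only [smul_eq_mul] at this
    rwa [mul_neg, mul_neg, ← neg_add, ← mul_add] at this
  have hlt : ∃ x, Real.exp (-(eval x ((1 / 2 : ℝ) • (f + g)))) < G x := by
    obtain ⟨x, hx⟩ : ∃ x, eval x f ≠ eval x g := by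
      by_contra! h
      exact hfg (MvPolynomial.funext h)
    refine ⟨x, ?_⟩
    rw [hev]
    have := strictConvexOn_exp.2 (Set.mem_univ (-(eval x f))) (Set.mem_univ (-(eval x g)))
      (fun h => hx (neg_injective h))
      (by norm_num : (0 : ℝ) < 1 / 2) (by norm_num : (0 : ℝ) < 1 / 2) (by norm_num)
    simp only [smul_eq_mul] at this
    rwa [mul_neg, mul_neg, ← neg_add, ← mul_add] at this
  have hfin : expIntegral ((1 / 2 : ℝ) • (f + g)) ≠ ⊤ :=
    ne_top_of_le_ne_top ENNReal.one_ne_top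
      ((lintegral_mono fun x => ENNReal.ofReal_le_ofReal (hle x)).trans hG)
  exact (lintegral_ofReal_lt_of_continuous (continuous_exp_neg_eval _) (by fun_prop)
    (fun x => (Real.exp_pos _).le) hle hlt hfin).trans_le hG

theorem expIntegral_pos {n : ℕ} (f : MvPolynomial (Fin n) ℝ) : 0 < expIntegral f := by
  have h := (continuous_exp_neg_eval f).measurable.ennreal_ofReal
  rw [expIntegral, lintegral_pos_iff_support h]
  have : (Function.support fun x => ENNReal.ofReal (Real.exp (-(eval x f)))) = Set.univ := by
    ext x; simp [Real.exp_pos]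
  rw [this]
  exact isOpen_univ.measure_pos volume Set.univ_nonempty

theorem expIntegral_zero {n : ℕ} (hn : 1 ≤ n) :
    expIntegral (0 : MvPolynomial (Fin n) ℝ) = ⊤ := by
  have : Nonempty (Fin n) := ⟨⟨0, hn⟩⟩
  simp [expIntegral]

theorem expIntegral_rotate {n : ℕ} {ρ : Matrix (Fin n) (Fin n) ℝ} (hρ : ρ * ρᵀ = 1)
    (f : MvPolynomial (Fin n) ℝ) : expIntegral (rotate n ρ f) = expIntegral f := by
  have hinv : ρ⁻¹ = ρᵀ := Matrix.inv_eq_right_inv hρ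
  have hdet : |(ρᵀ).det| = 1 := by
    have := congrArg Matrix.det hρ
    rw [det_mul, det_transpose, det_one] at this
    rw [det_transpose]
    rcases mul_self_eq_one_iff.1 this with h | h <;> simp [h]
  have hdet0 : (ρᵀ).det ≠ 0 := fun h => by simp [h] at hdet
  have hmap := Real.map_matrix_volume_pi_eq_smul_volume_pi hdet0
  rw [abs_inv, hdet, inv_one, ENNReal.ofReal_one, one_smul] at hmap
  unfold expIntegral
  conv_rhs => rw [← hmap]
  rw [lintegral_map (continuous_exp_neg_eval f).measurable.ennreal_ofReal
    (LinearMap.continuous_of_finiteDimensional _).measurable]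
  simp [eval_rotate, hinv]

theorem expIntegral_pow_smul {n d : ℕ} {f : MvPolynomial (Fin n) ℝ} (hf : f.IsHomogeneous d)
    {s : ℝ} (hs : 0 < s) :
    expIntegral (s ^ d • f) = ENNReal.ofReal (s ^ n)⁻¹ * expIntegral f := by
  have h : ∀ x, eval x (s ^ d • f) = eval (s • x) f := fun x => by
    rw [eval_smul_of_isHomogeneous hf]; simp
  simp_rw [expIntegral, h]
  have hmap := Measure.map_addHaar_smul (volume : Measure (Fin n → ℝ)) hs.ne'
  rw [← lintegral_map (f := fun y => ENNReal.ofReal (Real.exp (-(eval y f))))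
    (continuous_exp_neg_eval f).measurable.ennreal_ofReal (measurable_const_smul s), hmap,
    lintegral_smul_measure, Module.finrank_fin_fun, abs_of_pos (by positivity), smul_eq_mul]

theorem exists_orthogonal_inv_mulVec_eq {n : ℕ} {x y : Fin n → ℝ} (hxy : x ⬝ᵥ x = y ⬝ᵥ y) :
    ∃ ρ : Matrix (Fin n) (Fin n) ℝ, ρ * ρᵀ = 1 ∧ ρ⁻¹ *ᵥ x = y := by
  by_cases h : x = y
  · exact ⟨1, by simp, by simp [h]⟩
  set u := x - y with hu
  have hu0 : u ⬝ᵥ u ≠ 0 := fun h0 => h (sub_eq_zero.1 (dotProduct_self_eq_zero.1 h0))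
  have hux : 2 * (u ⬝ᵥ x) = u ⬝ᵥ u := by
    simp only [hu, sub_dotProduct, dotProduct_sub, dotProduct_comm y x]
    linarith
  set H : Matrix (Fin n) (Fin n) ℝ := 1 - (2 / (u ⬝ᵥ u)) • vecMulVec u u with hH
  have hT : Hᵀ = H := by
    rw [hH, transpose_sub, transpose_smul, transpose_vecMulVec, transpose_one]
  have hHH : H * Hᵀ = 1 := by
    rw [hT, hH]
    simp only [sub_mul, mul_sub, one_mul, mul_one, smul_mul_smul_comm, vecMulVec_mul_vecMulVec,
      vecMulVec_smul, smul_smul]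
    have : 2 / (u ⬝ᵥ u) * (2 / (u ⬝ᵥ u)) * (u ⬝ᵥ u) = 2 * (2 / (u ⬝ᵥ u)) := by
      field_simp
    rw [this, two_mul, add_smul]
    abel
  refine ⟨H, hHH, ?_⟩
  rw [Matrix.inv_eq_right_inv hHH, hT, hH, sub_mulVec, one_mulVec, smul_mulVec,
    vecMulVec_mulVec, op_smul_eq_smul, smul_smul]
  have : 2 / (u ⬝ᵥ u) * (u ⬝ᵥ x) = 1 := by
    rw [div_mul_eq_mul_div, hux, div_self hu0]
  rw [this, one_smul, hu, sub_sub_cancel]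

theorem eq_smul_ballForm_of_invariant {n d : ℕ} (hn : 1 ≤ n) (hd : Even d)
    {f : MvPolynomial (Fin n) ℝ} (hf : f.IsHomogeneous d)
    (hinv : ∀ ρ : Matrix (Fin n) (Fin n) ℝ, ρ * ρᵀ = 1 → rotate n ρ f = f) :
    ∃ c : ℝ, f = c • ballForm n d := by
  set e : Fin n → ℝ := Pi.single ⟨0, hn⟩ 1 with he
  refine ⟨eval e f, MvPolynomial.funext fun x => ?_⟩
  have hx : 0 ≤ x ⬝ᵥ x := by simpa using dotProduct_star_self_nonneg x
  obtain ⟨ρ, hρ, hρx⟩ := exists_orthogonal_inv_mulVec_eq (x := x) (y := √(x ⬝ᵥ x) • e) (by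
    simp [he, Real.mul_self_sqrt hx])
  have h1 : eval x f = eval (√(x ⬝ᵥ x) • e) f := by
    rw [← hρx, ← eval_rotate, hinv ρ hρ]
  rw [h1, eval_smul_of_isHomogeneous hf, smul_eval, eval_ballForm, mul_comm]
  conv_lhs => rw [← Nat.two_mul_div_two_of_even hd, pow_mul, Real.sq_sqrt hx]

theorem integral_exp_neg_sqrt_rpow {n : ℕ} (hn : 1 ≤ n) {p : ℝ} (hp : 0 < p) :
    ∫ x : Fin n → ℝ, Real.exp (-(√(x ⬝ᵥ x)) ^ p) =
      Real.Gamma (1 + n / p) / Real.Gamma (1 + (n : ℝ) / 2) * π ^ ((n : ℝ) / 2) := by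
  have : Nonempty (Fin n) := ⟨⟨0, hn⟩⟩
  have hg : ∀ x : Fin n → ℝ, √(x ⬝ᵥ x) = ‖WithLp.toLp 2 x‖ := fun x => by
    simp [EuclideanSpace.norm_eq, dotProduct, pow_two]
  have hvol := MeasureTheory.measure_lt_one_eq_integral_div_gamma
    (volume : Measure (Fin n → ℝ)) (g := fun x => √(x ⬝ᵥ x)) (by simp) (by simp)
    (fun x y => by simp only [hg, WithLp.toLp_add]; exact norm_add_le _ _)
    (fun {x} hx => by
      rw [hg, norm_eq_zero] at hx
      simpa using hx)
    (fun r x => by simp only [hg, WithLp.toLp_smul, norm_smul, Real.norm_eq_abs]; exact le_rfl)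
    hp
  have hvol2 := MeasureTheory.volume_sum_rpow_lt_one (Fin n) (p := 2) (by norm_num)
  have hset : {x : Fin n → ℝ | ∑ i, |x i| ^ (2 : ℝ) < 1} = {x | √(x ⬝ᵥ x) < 1} := by
    ext x
    simp [Real.sqrt_lt' one_pos, dotProduct, pow_two]
  rw [hset, hvol] at hvol2
  have hG : 0 < Real.Gamma (n / p + 1) := Real.Gamma_pos_of_pos (by positivity)
  have hG2 : 0 < Real.Gamma (n / 2 + 1) := Real.Gamma_pos_of_pos (by positivity)
  have hG3 : 2 * Real.Gamma (1 / 2 + 1) = √π := by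
    rw [Real.Gamma_add_one (by norm_num), Real.Gamma_one_half_eq]; ring
  have hI : 0 ≤ ∫ x : Fin n → ℝ, Real.exp (-(√(x ⬝ᵥ x)) ^ p) :=
    integral_nonneg fun x => (Real.exp_pos _).le
  rw [hG3, Fintype.card_fin, Module.finrank_fin_fun,
    ENNReal.ofReal_eq_ofReal_iff (by positivity) (by positivity), div_eq_iff hG.ne'] at hvol2
  have hpi : π ^ ((n : ℝ) / 2) = √π ^ n := by
    rw [Real.sqrt_eq_rpow, ← Real.rpow_mul_natCast pi_pos.le]; congr 1; ring
  rw [hvol2, hpi, add_comm 1, add_comm 1]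
  field_simp

theorem kappa_pos {n d : ℕ} : 0 < kappa n d := by
  unfold kappa
  have h1 : 0 < Real.Gamma (1 + (n : ℝ) / d) := Real.Gamma_pos_of_pos (by positivity)
  have h2 : 0 < Real.Gamma (1 + (n : ℝ) / 2) := Real.Gamma_pos_of_pos (by positivity)
  positivity

theorem expIntegral_kappa_smul_ballForm {n d : ℕ} (hn : 1 ≤ n) (hd : 2 ≤ d) (hdeven : Even d) :
    expIntegral (kappa n d • ballForm n d) = 1 := by
  have hd0 : (0 : ℝ) < d := by positivity
  have hn0 : (0 : ℝ) < n := by positivity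
  set I := Real.Gamma (1 + n / (d : ℝ)) / Real.Gamma (1 + (n : ℝ) / 2) * π ^ ((n : ℝ) / 2) with hI
  have h1 : 0 < Real.Gamma (1 + (n : ℝ) / d) := Real.Gamma_pos_of_pos (by positivity)
  have h2 : 0 < Real.Gamma (1 + (n : ℝ) / 2) := Real.Gamma_pos_of_pos (by positivity)
  have hIpos : 0 < I := by positivity
  have hball : expIntegral (ballForm n d) = ENNReal.ofReal I := by
    have hint := integral_exp_neg_sqrt_rpow hn hd0
    have hfun : ∀ x : Fin n → ℝ, √(x ⬝ᵥ x) ^ (d : ℝ) = eval x (ballForm n d) := fun x => by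
      have hx : 0 ≤ x ⬝ᵥ x := by simpa using dotProduct_star_self_nonneg x
      rw [eval_ballForm, Real.rpow_natCast]
      conv_lhs => rw [← Nat.two_mul_div_two_of_even hdeven, pow_mul, Real.sq_sqrt hx]
    simp_rw [hfun] at hint
    rw [expIntegral, ← ofReal_integral_eq_lintegral_ofReal, hint]
    · by_contra h
      rw [integral_undef h] at hint
      exact hIpos.ne hint
    · exact Filter.Eventually.of_forall fun x => (Real.exp_pos _).le
  set s := I ^ (1 / (n : ℝ)) with hs
  have hs0 : 0 < s := by positivity
  have hk : kappa n d = s ^ d := by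
    rw [hs, ← Real.rpow_mul_natCast hIpos.le, hI, Real.mul_rpow (by positivity) (by positivity),
      ← Real.rpow_mul pi_pos.le, kappa]
    congr 2 <;> field_simp
  have hsn : s ^ n = I := by
    rw [hs, ← Real.rpow_mul_natCast hIpos.le, one_div, inv_mul_cancel₀ hn0.ne', Real.rpow_one]
  rw [hk, expIntegral_pow_smul (isHomogeneous_ballForm hdeven) hs0, hball, hsn,
    ← ENNReal.ofReal_mul (by positivity), inv_mul_cancel₀ hIpos.ne', ENNReal.ofReal_one]

theorem exists_shrink_expIntegral_le_one {n d : ℕ} (hn : 1 ≤ n) (hd : 2 ≤ d)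
    {f : MvPolynomial (Fin n) ℝ} (hf : f.IsHomogeneous d) (hlt : expIntegral f < 1) :
    ∃ t : ℝ, 0 ≤ t ∧ t < 1 ∧ expIntegral (t • f) ≤ 1 := by
  set I := (expIntegral f).toReal with hI
  have htop : expIntegral f ≠ ⊤ := hlt.ne_top
  have hI0 : 0 < I := ENNReal.toReal_pos (expIntegral_pos f).ne' htop
  have hI1 : I < 1 := by simpa using (ENNReal.toReal_lt_toReal htop ENNReal.one_ne_top).2 hlt
  have hn0 : (0 : ℝ) < n := by positivity
  set s := I ^ (1 / (n : ℝ)) with hs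
  have hs0 : 0 < s := by positivity
  have hs1 : s < 1 := Real.rpow_lt_one hI0.le hI1 (by positivity)
  have hsn : s ^ n = I := by
    rw [hs, ← Real.rpow_mul_natCast hI0.le, one_div, inv_mul_cancel₀ hn0.ne', Real.rpow_one]
  refine ⟨s ^ d, by positivity, pow_lt_one₀ hs0.le hs1 (by lia), ?_⟩
  rw [expIntegral_pow_smul hf hs0, hsn, ← ENNReal.ofReal_toReal htop, ← hI,
    ← ENNReal.ofReal_mul (by positivity), inv_mul_cancel₀ hI0.ne', ENNReal.ofReal_one]

/-- A closed nonempty set avoiding the origin in which midpoints of distinct points can be shrunk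
has a unique element of least norm. -/
theorem exists_unique_minimal_norm {E : Type*} [NormedAddCommGroup E] [NormedSpace ℝ E]
    [FiniteDimensional ℝ E] {S : Set E} (hS : IsClosed S) (hne : S.Nonempty) (h0 : (0 : E) ∉ S)
    (hmid : ∀ f ∈ S, ∀ g ∈ S, f ≠ g →
      ∃ t : ℝ, 0 ≤ t ∧ t < 1 ∧ t • ((1 / 2 : ℝ) • (f + g)) ∈ S) :
    ∃ g ∈ S, (∀ f ∈ S, ‖g‖ ≤ ‖f‖) ∧ ∀ f ∈ S, ‖f‖ = ‖g‖ → f = g := by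
  have : ProperSpace E := FiniteDimensional.proper ℝ E
  obtain ⟨g, hgS, hg⟩ := hS.exists_infDist_eq_dist hne 0
  have hmin : ∀ f ∈ S, ‖g‖ ≤ ‖f‖ := fun f hf => by
    have := Metric.infDist_le_dist_of_mem (x := (0 : E)) hf
    rwa [hg, dist_zero_left, dist_zero_left] at this
  refine ⟨g, hgS, hmin, fun f hf hfg => ?_⟩
  by_contra hne
  obtain ⟨t, ht0, ht1, ht⟩ := hmid f hf g hgS hne
  have hg0 : 0 < ‖g‖ := norm_pos_iff.2 fun h => h0 (h ▸ hgS)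
  have h1 := hmin _ ht
  rw [norm_smul, norm_smul, Real.norm_eq_abs, Real.norm_eq_abs, abs_of_nonneg ht0,
    abs_of_pos (by norm_num)] at h1
  nlinarith [norm_add_le f g]

theorem isClosed_expIntegral_le {E : Type*} {n : ℕ} [NormedAddCommGroup E] [NormedSpace ℝ E]
    [FiniteDimensional ℝ E] (φ : E →ₗ[ℝ] MvPolynomial (Fin n) ℝ) (r : ENNReal) :
    IsClosed {f : E | expIntegral (φ f) ≤ r} := by
  refine IsSeqClosed.isClosed fun u f hu huf => ?_
  have hcont : ∀ x : Fin n → ℝ, Continuous fun g : E => eval x (φ g) := fun x =>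
    LinearMap.continuous_of_finiteDimensional ((aeval (R := ℝ) x).toLinearMap ∘ₗ φ)
  have hlim : ∀ x : Fin n → ℝ, Filter.liminf
      (fun k => ENNReal.ofReal (Real.exp (-(eval x (φ (u k)))))) Filter.atTop =
      ENNReal.ofReal (Real.exp (-(eval x (φ f)))) := fun x =>
    Filter.Tendsto.liminf_eq <| (ENNReal.continuous_ofReal.tendsto _).comp <|
      (Real.continuous_exp.tendsto _).comp (((hcont x).tendsto f).comp huf).neg
  calc expIntegral (φ f) = ∫⁻ x : Fin n → ℝ, Filter.liminf
        (fun k => ENNReal.ofReal (Real.exp (-(eval x (φ (u k)))))) Filter.atTop := by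
        simp_rw [hlim]; rfl
    _ ≤ Filter.liminf (fun k => expIntegral (φ (u k))) Filter.atTop :=
        lintegral_liminf_le fun k => (continuous_exp_neg_eval _).measurable.ennreal_ofReal
    _ ≤ r := Filter.liminf_le_of_frequently_le' (Filter.Frequently.of_forall hu)

/-- The unique minimizer of a norm on degree `d` forms subject to `∫ exp(-f) ≤ 1`. -/
theorem exists_unique_minimizer {n d : ℕ} (hn : 1 ≤ n) (hd : 2 ≤ d) (hdeven : Even d)
    {Nm : MvPolynomial (Fin n) ℝ → ℝ}
    (Nm_add : ∀ f g : MvPolynomial (Fin n) ℝ, f.IsHomogeneous d → g.IsHomogeneous d →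
      Nm (f + g) ≤ Nm f + Nm g)
    (Nm_smul : ∀ (c : ℝ) (f : MvPolynomial (Fin n) ℝ), f.IsHomogeneous d →
      Nm (c • f) = |c| * Nm f)
    (Nm_eq_zero : ∀ f : MvPolynomial (Fin n) ℝ, f.IsHomogeneous d → (Nm f = 0 ↔ f = 0)) :
    ∃ g : MvPolynomial (Fin n) ℝ, g.IsHomogeneous d ∧ expIntegral g ≤ 1 ∧
      (∀ f : MvPolynomial (Fin n) ℝ, f.IsHomogeneous d → expIntegral f ≤ 1 → Nm g ≤ Nm f) ∧
      ∀ f : MvPolynomial (Fin n) ℝ, f.IsHomogeneous d → expIntegral f ≤ 1 →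
        Nm f = Nm g → f = g := by
  let E := homogeneousSubmodule (Fin n) ℝ d
  let : Norm E := ⟨fun f => Nm f⟩
  have core : NormedSpace.Core ℝ E :=
    { norm_nonneg := fun f => by
        have h0 := (Nm_eq_zero 0 (isHomogeneous_zero _ _ _)).2 rfl
        have h1 := Nm_smul (-1) f f.2
        have h2 := Nm_add f ((-1 : ℝ) • f) f.2 (E.smul_mem _ f.2)
        rw [h1, neg_smul, one_smul, add_neg_cancel, h0, abs_neg, abs_one] at h2
        change 0 ≤ Nm f
        linarith
      norm_smul := fun c f => Nm_smul c f f.2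
      norm_triangle := fun f g => Nm_add f g f.2 g.2
      norm_eq_zero_iff := fun f => (Nm_eq_zero f f.2).trans (by simp) }
  let : NormedAddCommGroup E := NormedAddCommGroup.ofCore core
  let : NormedSpace ℝ E := NormedSpace.ofCore core
  have : FiniteDimensional ℝ E :=
    Module.Finite.iff_fg.2 (homogeneousSubmodule_fg (σ := Fin n) (R := ℝ) d)
  obtain ⟨g, hgS, hmin, huniq⟩ := exists_unique_minimal_norm
    (isClosed_expIntegral_le (E := E) E.subtype 1)
    ⟨⟨kappa n d • ballForm n d, E.smul_mem _ (isHomogeneous_ballForm hdeven)⟩,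
      (expIntegral_kappa_smul_ballForm hn hd hdeven).le⟩
    (by simp [expIntegral_zero hn])
    (fun f hf g hg hfg => exists_shrink_expIntegral_le_one hn hd
      (E.smul_mem _ (E.add_mem f.2 g.2))
      (expIntegral_midpoint_lt (fun h => hfg (Subtype.ext h)) hf hg))
  exact ⟨g, g.2, hgS, fun f hf hfI => hmin ⟨f, hf⟩ hfI,
    fun f hf hfI h => congrArg Subtype.val (huniq ⟨f, hf⟩ hfI h)⟩

/-- For an `O(n)`-invariant norm `‖·‖` on degree-`d` forms, among all forms `f` of degree `d`
with `∫ exp(-f) dx ≤ 1`, the norm `‖f‖` is uniquely minimized by `f = κ·b_{d,n}`, and the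
minimum value is `κ·‖b_{d,n}‖`. -/
theorem stmt10 (n d : ℕ) (hn : 1 ≤ n) (hd : 2 ≤ d) (hdeven : Even d)
    (Nm : MvPolynomial (Fin n) ℝ → ℝ)
    (Nm_add : ∀ f g : MvPolynomial (Fin n) ℝ, f.IsHomogeneous d → g.IsHomogeneous d →
      Nm (f + g) ≤ Nm f + Nm g)
    (Nm_smul : ∀ (c : ℝ) (f : MvPolynomial (Fin n) ℝ), f.IsHomogeneous d →
      Nm (c • f) = |c| * Nm f)
    (Nm_eq_zero : ∀ f : MvPolynomial (Fin n) ℝ, f.IsHomogeneous d → (Nm f = 0 ↔ f = 0))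
    (Nm_inv : ∀ ρ : Matrix (Fin n) (Fin n) ℝ, ρ * ρᵀ = 1 →
      ∀ f : MvPolynomial (Fin n) ℝ, f.IsHomogeneous d → Nm (rotate n ρ f) = Nm f) :
    (∫⁻ x : Fin n → ℝ, ENNReal.ofReal (Real.exp (-(eval x (kappa n d • ballForm n d)))) ≤ 1) ∧
    Nm (kappa n d • ballForm n d) = kappa n d * Nm (ballForm n d) ∧
    (∀ f : MvPolynomial (Fin n) ℝ, f.IsHomogeneous d →
      (∫⁻ x : Fin n → ℝ, ENNReal.ofReal (Real.exp (-(eval x f)))) ≤ 1 →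
      kappa n d * Nm (ballForm n d) ≤ Nm f) ∧
    (∀ f : MvPolynomial (Fin n) ℝ, f.IsHomogeneous d →
      (∫⁻ x : Fin n → ℝ, ENNReal.ofReal (Real.exp (-(eval x f)))) ≤ 1 →
      Nm f = kappa n d * Nm (ballForm n d) → f = kappa n d • ballForm n d) := by
  obtain ⟨g, hg, hgI, hmin, huniq⟩ := exists_unique_minimizer hn hd hdeven Nm_add Nm_smul Nm_eq_zero
  have hb := isHomogeneous_ballForm (n := n) hdeven
  have hkb : (kappa n d • ballForm n d).IsHomogeneous d :=
    (homogeneousSubmodule (Fin n) ℝ d).smul_mem _ hb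
  have hkI := expIntegral_kappa_smul_ballForm hn hd hdeven
  have hk := kappa_pos (n := n) (d := d)
  have hNk : Nm (kappa n d • ballForm n d) = kappa n d * Nm (ballForm n d) := by
    rw [Nm_smul _ _ hb, abs_of_pos hk]
  obtain ⟨c, hc⟩ := eq_smul_ballForm_of_invariant hn hdeven hg fun ρ hρ =>
    huniq _ (isHomogeneous_rotate ρ hg) ((expIntegral_rotate hρ g).trans_le hgI)
      (Nm_inv ρ hρ g hg)
  have hcg : g = kappa n d • ballForm n d := by
    refine (huniq _ hkb hkI.le (le_antisymm ?_ (hmin _ hkb hkI.le))).symm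
    have hNg : Nm g = |c| * Nm (ballForm n d) := by rw [hc, Nm_smul _ _ hb]
    have hNb : 0 ≤ Nm (ballForm n d) := by
      have h0 := hmin _ hkb hkI.le
      have h1 := abs_nonneg c
      by_contra! hneg
      have h2 := Nm_add _ _ hb ((homogeneousSubmodule (Fin n) ℝ d).smul_mem (-1) hb)
      rw [Nm_smul _ _ hb, neg_smul, one_smul, add_neg_cancel,
        (Nm_eq_zero 0 (isHomogeneous_zero _ _ _)).2 rfl, abs_neg, abs_one] at h2
      linarith
    rw [hNk, hNg]
    refine mul_le_mul_of_nonneg_right (le_trans ?_ (le_abs_self c)) hNb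
    by_contra! hlt
    have hb0 : ∀ x : Fin n → ℝ, 0 ≤ eval x (ballForm n d) := fun x => by
      rw [eval_ballForm]
      exact pow_nonneg (by simpa using dotProduct_star_self_nonneg x) _
    refine absurd (hgI.trans hkI.ge) (not_le.2 (lintegral_ofReal_lt_of_continuous
      (continuous_exp_neg_eval _) (continuous_exp_neg_eval _) (fun x => (Real.exp_pos _).le)
      (fun x => ?_) ⟨Pi.single ⟨0, hn⟩ 1, ?_⟩ (hkI.trans_ne ENNReal.one_ne_top)))
    · rw [hc, smul_eval, smul_eval, Real.exp_le_exp, neg_le_neg_iff]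
      exact mul_le_mul_of_nonneg_right hlt.le (hb0 x)
    · rw [hc, smul_eval, smul_eval, Real.exp_lt_exp, neg_lt_neg_iff]
      simpa [eval_ballForm] using hlt
  subst hcg
  refine ⟨hkI.le, hNk, fun f hf hfI => hNk ▸ hmin f hf hfI, fun f hf hfI h => ?_⟩
  exact huniq f hf hfI (h.trans hNk.symm)
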